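/- Let P ⊆ ℝ^k be a polytope, and for every nonempty face σ of P (including P itself) choose a point y_σ ∈ σ and a set A_σ ⊆ P that is open in P. If σ ⊆ ⋃_{τ ⊆ σ, τ a nonempty face} A_τ for every nonempty face σ of P, then there exist nonempty faces σ_1, …, σ_m of P such that y_P ∈ conv{y_{σ_1}, …, y_{σ_m}} and ⋂_{i=1}^m A_{σ_i} ≠ ∅. -/

import Mathlib

/-- A finite set `S` is dominating for the rankings `r i` if no `y` lies strictly above
the `r i`-minimum of `S` for every `i`. -/
def IsDominating {ι X L : Type*} [LE L] (r : ι → X → L) (S : Finset X) : Prop :=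
  ∀ y, ∃ i, ∀ x ∈ S, r i y ≤ r i x

theorem IsDominating.mono {ι X L : Type*} [LE L] {r : ι → X → L} {S T : Finset X}
    (hS : IsDominating r S) (h : T ⊆ S) : IsDominating r T := fun y =>
  let ⟨i, hi⟩ := hS y
  ⟨i, fun x hx => hi x (h hx)⟩

open Finset in
/-- In a set with as many elements as there are colours, but missing some colour, the number
of elements whose removal leaves exactly the colours different from `i₀` is even. -/
theorem even_card_filter_image_erase {ι X : Type*} [Fintype ι] [DecidableEq ι]
    [DecidableEq X] (c : X → ι) (i₀ : ι) (S : Finset X) (hS : #S = Fintype.card ι)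
    (hc : S.image c ≠ univ) :
    Even #{x ∈ S | (S.erase x).image c = univ.erase i₀} := by
  have hinj : ∀ x ∈ S, (S.erase x).image c = univ.erase i₀ →
      Set.InjOn c (S.erase x : Finset X) := by
    intro x hx h
    apply Finset.injOn_of_card_image_eq
    rw [h, card_erase_of_mem (mem_univ _), card_erase_of_mem hx, hS, card_univ]
  rcases Finset.eq_empty_or_nonempty {x ∈ S | (S.erase x).image c = univ.erase i₀} with h | ⟨x, hx⟩
  · simp [h]
  obtain ⟨hxS, hx⟩ := mem_filter.1 hx
  have hcx : c x ∈ univ.erase i₀ := by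
    refine mem_erase.2 ⟨fun h => hc ?_, mem_univ _⟩
    rw [← insert_erase hxS, image_insert, hx, h, insert_erase (mem_univ _)]
  obtain ⟨z, hz, hzx⟩ := mem_image.1 (hx ▸ hcx)
  obtain ⟨hne, hzS⟩ := mem_erase.1 hz
  have hz' : (S.erase z).image c = univ.erase i₀ := by
    have h1 : S.erase z = insert x ((S.erase x).erase z) := by
      rw [erase_right_comm, insert_erase (mem_erase.2 ⟨hne.symm, hxS⟩)]
    rw [h1, image_insert, ← hzx, ← image_insert, insert_erase hz, hx]
  have : ({x ∈ S | (S.erase x).image c = univ.erase i₀} : Finset X) = {x, z} := by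
    ext u
    simp only [mem_filter, mem_insert, mem_singleton]
    constructor
    · rintro ⟨huS, hu⟩
      by_contra! hcon
      exact hne (hinj u huS hu (by simp [hcon.2.symm, hzS]) (by simp [hcon.1.symm, hxS]) hzx)
    · rintro (rfl | rfl)
      exacts [⟨hxS, hx⟩, ⟨hzS, hz'⟩]
  rw [this, card_pair hne.symm]
  exact even_two

open Finset in
/-- Let `τ` have one element less than the number of rankings and contain some `t` that is ranked
below `s k` by every ranking other than the `k`-th. Then `τ` extends by one
point to a dominating set in an even number of ways. -/
theorem even_card_filter_isDominating_insert {ι X L : Type*} [Fintype ι] [DecidableEq ι]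
    [DecidableEq X] [Fintype X] [LinearOrder L] (r : ι → X → L)
    (hr : ∀ i, Function.Injective (r i)) (s : ι → X) (τ : Finset X)
    (hτ : #τ + 1 = Fintype.card ι) (t : X) (ht : t ∈ τ)
    (hts : ∀ l k, l ≠ k → r l t < r l (s k)) [DecidablePred (IsDominating r)] :
    Even #{x | x ∉ τ ∧ IsDominating r (insert x τ)} := by
  rcases Finset.eq_empty_or_nonempty {x | x ∉ τ ∧ IsDominating r (insert x τ)} with h | ⟨x₀, hx₀⟩
  · simp [h]
  have hdom : IsDominating r τ := (mem_filter.1 hx₀).2.2.mono (subset_insert _ _)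
  choose m hmτ hm using fun i => exists_min_image τ (r i) ⟨t, ht⟩
  have hsurj : ∀ x ∈ τ, ∃ i, m i = x := fun x hx =>
    let ⟨i, hi⟩ := hdom x
    ⟨i, hr i (le_antisymm (hm i x hx) (hi _ (hmτ i)))⟩
  obtain ⟨i, j, hij, hmij, huniq⟩ : ∃ i j, i ≠ j ∧ m i = m j ∧
      ∀ a b, a ≠ b → m a = m b → (a = i ∧ b = j) ∨ (a = j ∧ b = i) := by
    have : Nonempty ι := ⟨(hsurj t ht).choose⟩
    choose! g hg using hsurj
    have hlt : #(τ.image g) < #(univ : Finset ι) := by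
      rw [card_univ, ← hτ]
      exact Nat.lt_succ_of_le card_image_le
    obtain ⟨i, -, hi⟩ := exists_mem_notMem_of_card_lt_card hlt
    have hgi : ∀ x ∈ τ, g x ≠ i := fun x hx h => hi (mem_image.2 ⟨x, hx, h⟩)
    have himg : ∀ a, a ≠ i → g (m a) = a := by
      intro a ha
      have hcard : #(τ.image g) = #τ := card_image_of_injOn fun x hx y hy h => by
        rw [← hg x hx, ← hg y hy, h]
      have : τ.image g = univ.erase i := by
        apply eq_of_subset_of_card_le
        · intro b hb
          obtain ⟨x, hx, rfl⟩ := mem_image.1 hb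
          simp [hgi x hx]
        · rw [hcard, card_erase_of_mem (mem_univ _), card_univ, ← hτ]; simp
      obtain ⟨x, hx, rfl⟩ := mem_image.1 (this.symm ▸ mem_erase.2 ⟨ha, mem_univ a⟩ : a ∈ τ.image g)
      rw [hg x hx]
    refine ⟨i, g (m i), (hgi _ (hmτ i)).symm, (hg _ (hmτ i)).symm, fun a b hab h => ?_⟩
    by_cases ha : a = i
    · subst ha
      exact Or.inl ⟨rfl, by rw [h, himg b hab.symm]⟩
    · by_cases hb : b = i
      · subst hb
        exact Or.inr ⟨by rw [← h, himg a ha], rfl⟩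
      · exact (hab (by rw [← himg a ha, ← himg b hb, h])).elim
  let Φ : ι → X → Prop := fun k x => (∀ l, l ≠ k → r l (m l) < r l x) ∧
    ∀ y, (∀ l, l ≠ k → r l (m l) < r l y) → r k y ≤ r k x
  have hex : ∀ k, ∃ x, Φ k x := by
    intro k
    classical
    obtain ⟨x, hx, hmax⟩ := exists_max_image {x | ∀ l, l ≠ k → r l (m l) < r l x} (r k)
      ⟨s k, by simpa using fun l hl => (hm l t ht).trans_lt (hts l k hl)⟩
    exact ⟨x, by simpa using hx, fun y hy => hmax y (by simpa using hy)⟩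
  have huniqΦ : ∀ k x y, Φ k x → Φ k y → x = y := fun k x y hx hy =>
    hr k (le_antisymm (hy.2 x hx.1) (hx.2 y hy.1))
  have hcoll : ∀ k, (k = i ∨ k = j) ↔ ∃ l, l ≠ k ∧ m l = m k := by
    intro k
    constructor
    · rintro (rfl | rfl)
      exacts [⟨j, hij.symm, hmij.symm⟩, ⟨i, hij, hmij⟩]
    · rintro ⟨l, hl, h⟩
      rcases huniq l k hl h with h | h
      exacts [Or.inr h.2, Or.inl h.2]
  have hiff : ∀ x, (x ∉ τ ∧ IsDominating r (insert x τ)) ↔ Φ i x ∨ Φ j x := by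
    intro x
    constructor
    · rintro ⟨hx, hd⟩
      obtain ⟨k, hk⟩ := hd x
      have hz : ∀ z ∈ τ, ∃ l, l ≠ k ∧ m l = z ∧ r l z < r l x := by
        intro z hz
        obtain ⟨l, hl⟩ := hd z
        have hlt : r l z < r l x := lt_of_le_of_ne (hl x (mem_insert_self _ _))
          fun h => hx (hr l h ▸ hz)
        refine ⟨l, ?_, ?_, hlt⟩
        · rintro rfl
          exact (hk z (mem_insert_of_mem hz)).not_gt hlt
        · exact hr l (le_antisymm (hm l z hz) (hl _ (mem_insert_of_mem (hmτ l))))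
      have hkij : k = i ∨ k = j := (hcoll k).2 <|
        let ⟨l, h1, h2, _⟩ := hz _ (hmτ k)
        ⟨l, h1, h2⟩
      have hΦ : Φ k x := by
        refine ⟨fun l hl => ?_, fun y hy => ?_⟩
        · obtain ⟨l', hl', h1, h2⟩ := hz _ (hmτ l)
          by_cases h : l' = l
          · rwa [h] at h2
          · exfalso
            rcases huniq l' l h h1 with h | h <;> rcases hkij with h' | h' <;> grind
        · obtain ⟨l, hl⟩ := hd y
          by_cases h : l = k
          · subst h
            exact hl x (mem_insert_self _ _)
          · exact absurd (hl _ (mem_insert_of_mem (hmτ l))) (hy l h).not_ge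
      rcases hkij with rfl | rfl
      exacts [Or.inl hΦ, Or.inr hΦ]
    · intro h
      obtain ⟨k, hkij, hΦ⟩ : ∃ k, (k = i ∨ k = j) ∧ Φ k x := by
        rcases h with h | h
        exacts [⟨i, Or.inl rfl, h⟩, ⟨j, Or.inr rfl, h⟩]
      refine ⟨fun hx => ?_, fun y => ?_⟩
      · obtain ⟨l, hl, hlx⟩ : ∃ l, l ≠ k ∧ m l = x := by
          obtain ⟨l, hl⟩ := hsurj x hx
          by_cases h : l = k
          · obtain ⟨l', h1, h2⟩ := (hcoll k).1 hkij
            exact ⟨l', h1, by rw [h2, ← h, hl]⟩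
          · exact ⟨l, h, hl⟩
        exact (hΦ.1 l hl).ne (by rw [hlx])
      · by_contra! hcon
        have hy : ∀ l, l ≠ k → r l (m l) < r l y := by
          intro l hl
          obtain ⟨z, hz, hzy⟩ := hcon l
          rcases mem_insert.1 hz with rfl | hz
          exacts [(hΦ.1 l hl).trans hzy, (hm l z hz).trans_lt hzy]
        have hyk : r k (m k) < r k y := by
          obtain ⟨z, hz, hzy⟩ := hcon k
          rcases mem_insert.1 hz with rfl | hz
          exacts [absurd (hΦ.2 y hy) hzy.not_ge, (hm k z hz).trans_lt hzy]
        obtain ⟨l, hl⟩ := hdom y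
        refine (hl _ (hmτ l)).not_gt ?_
        by_cases h : l = k
        exacts [h ▸ hyk, hy l h]
  obtain ⟨xi, hxi⟩ := hex i
  obtain ⟨xj, hxj⟩ := hex j
  have hne : xi ≠ xj := by
    rintro rfl
    obtain ⟨l, hl⟩ := hdom xi
    refine (hl _ (hmτ l)).not_gt ?_
    by_cases h : l = i
    · exact hxj.1 l (h ▸ hij)
    · exact hxi.1 l h
  have : ({x | x ∉ τ ∧ IsDominating r (insert x τ)} : Finset X) = {xi, xj} := by
    ext x
    rw [mem_filter, hiff]
    simp only [mem_univ, true_and, mem_insert, mem_singleton]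
    constructor
    · rintro (h | h)
      exacts [Or.inl (huniqΦ _ _ _ h hxi), Or.inr (huniqΦ _ _ _ h hxj)]
    · rintro (rfl | rfl)
      exacts [Or.inl hxi, Or.inr hxj]
  rw [this, card_pair hne]
  exact even_two

open Finset in
/-- All slack elements but one extend uniquely to a dominating set. -/
theorem card_filter_isDominating_insert_slack {ι X L : Type*} [Fintype ι] [DecidableEq ι]
    [DecidableEq X] [Fintype X] [LinearOrder L] (r : ι → X → L)
    (hr : ∀ i, Function.Injective (r i)) (s : ι → X)
    (hs : ∀ i x, x ≠ s i → r i (s i) < r i x)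
    (hs' : ∀ x, x ∉ Set.range s → ∀ i j, i ≠ j → r i x < r i (s j))
    (hX : ∃ x, x ∉ Set.range s) (i₀ : ι) [DecidablePred (IsDominating r)] :
    #{x | x ∉ (univ.erase i₀).image s ∧
      IsDominating r (insert x ((univ.erase i₀).image s))} = 1 := by
  classical
  obtain ⟨u, hu⟩ := hX
  obtain ⟨x, hx, hmax⟩ := exists_max_image {x | x ∉ Set.range s} (r i₀) ⟨u, by simpa using hu⟩
  have hx : x ∉ Set.range s := by simpa using hx
  replace hmax : ∀ y, y ∉ Set.range s → r i₀ y ≤ r i₀ x := fun y hy => hmax y (by simpa using hy)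
  have hle : ∀ i y, r i (s i) ≤ r i y := fun i y => by
    by_cases h : y = s i
    exacts [h ▸ le_rfl, (hs i y h).le]
  rw [card_eq_one]
  refine ⟨x, ?_⟩
  ext z
  simp only [mem_filter, mem_univ, true_and, mem_singleton]
  constructor
  · rintro ⟨hz, hd⟩
    obtain ⟨i, hi⟩ := hd x
    have hxs : ∀ i, x ≠ s i := fun i h => hx ⟨i, h.symm⟩
    have hii : i = i₀ := by
      by_contra h
      exact (hs i x (hxs i)).not_ge
        (hi _ (mem_insert_of_mem (mem_image_of_mem _ (mem_erase.2 ⟨h, mem_univ _⟩))))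
    subst hii
    have hxz := hi z (mem_insert_self _ _)
    refine hr i (le_antisymm (hmax z ?_) hxz)
    rintro ⟨l, rfl⟩
    by_cases hl : l = i
    · subst hl
      exact (hs l x (hxs l)).not_ge hxz
    · exact hz (mem_image_of_mem _ (mem_erase.2 ⟨hl, mem_univ _⟩))
  · rintro rfl
    refine ⟨fun h => ?_, fun y => ?_⟩
    · obtain ⟨l, -, hl⟩ := mem_image.1 h
      exact hx ⟨l, hl⟩
    · by_cases hy : y ∈ Set.range s
      · obtain ⟨l, rfl⟩ := hy
        exact ⟨l, fun w _ => hle l w⟩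
      · refine ⟨i₀, fun w hw => ?_⟩
        rcases mem_insert.1 hw with rfl | hw
        · exact hmax y hy
        · obtain ⟨l, hl, rfl⟩ := mem_image.1 hw
          exact (hs' y hy i₀ l (ne_of_mem_erase hl).symm).le

open Finset in
/-- **Scarf's lemma** on primitive sets: for every colouring that gives the slack element `s i` the
colour `i`, there is a dominating set of full colour. -/
theorem exists_isDominating_image_eq_univ {ι X L : Type*} [Fintype ι] [Nonempty ι]
    [DecidableEq ι] [DecidableEq X] [Fintype X] [LinearOrder L] (r : ι → X → L)
    (hr : ∀ i, Function.Injective (r i)) (s : ι → X)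
    (hs : ∀ i x, x ≠ s i → r i (s i) < r i x)
    (hs' : ∀ x, x ∉ Set.range s → ∀ i j, i ≠ j → r i x < r i (s j))
    (hX : ∃ x, x ∉ Set.range s) (c : X → ι) (hc : ∀ i, c (s i) = i) :
    ∃ S : Finset X, IsDominating r S ∧ S.image c = univ := by
  classical
  by_contra! hno
  obtain ⟨i₀⟩ := ‹Nonempty ι›
  let Ω : Finset (Finset X × X) := {p | #p.1 = Fintype.card ι ∧ IsDominating r p.1 ∧ p.2 ∈ p.1 ∧
    (p.1.erase p.2).image c = univ.erase i₀}
  have heven : Even #Ω := by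
    rw [card_eq_sum_card_image Prod.fst]
    refine even_sum _ fun S hS => ?_
    obtain ⟨p, hp, rfl⟩ := mem_image.1 hS
    obtain ⟨-, hcard, hd, -⟩ := mem_filter.1 hp
    have := even_card_filter_image_erase c i₀ p.1 hcard (hno _ hd)
    suffices h : #{q ∈ Ω | q.1 = p.1} = #{x ∈ p.1 | (p.1.erase x).image c = univ.erase i₀} by
      rwa [h]
    refine card_bij' (fun q _ => q.2) (fun x _ => (p.1, x)) ?_ ?_ ?_ ?_ <;>
      simp +contextual [Ω, Prod.ext_iff, hcard, hd]
    intro q1 q2 _ _ h1 h2 h3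
    subst h3
    exact ⟨h1, h2⟩
  have hfib : ∀ τ : Finset X, #τ + 1 = Fintype.card ι → τ.image c = univ.erase i₀ →
      #{p ∈ Ω | p.1.erase p.2 = τ} = #{x | x ∉ τ ∧ IsDominating r (insert x τ)} := by
    intro τ hτ hτc
    refine card_bij' (fun q _ => q.2) (fun x _ => (insert x τ, x)) ?_ ?_ ?_ ?_
    · rintro ⟨S, x⟩ hq
      simp only [mem_filter, Ω, mem_univ, true_and] at hq ⊢
      obtain ⟨⟨_, hd, hxS, _⟩, rfl⟩ := hq
      exact ⟨notMem_erase _ _, by rwa [insert_erase hxS]⟩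
    · intro x hx
      simp only [mem_filter, Ω, mem_univ, true_and] at hx ⊢
      simp [erase_insert hx.1, hτc, hx.2, card_insert_of_notMem hx.1, hτ]
    · rintro ⟨S, x⟩ hq
      simp only [mem_filter, Ω, mem_univ, true_and] at hq ⊢
      obtain ⟨⟨_, hd, hxS, _⟩, rfl⟩ := hq
      rw [insert_erase hxS]
    · intros; rfl
  have hsinj : Function.Injective s := fun i j h => by rw [← hc i, h, hc]
  set τ₀ : Finset X := (univ.erase i₀).image s with hτ₀
  have hτ₀c : τ₀.image c = univ.erase i₀ := by
    rw [hτ₀, image_image, show c ∘ s = id from funext hc, image_id]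
  have hpos : 0 < Fintype.card ι := Fintype.card_pos_iff.2 ⟨i₀⟩
  have hτ₀card : #τ₀ + 1 = Fintype.card ι := by
    rw [hτ₀, card_image_of_injective _ hsinj, card_erase_of_mem (mem_univ _), card_univ]
    lia
  have hone : #{p ∈ Ω | p.1.erase p.2 = τ₀} = 1 := by
    rw [hfib τ₀ hτ₀card hτ₀c]
    exact card_filter_isDominating_insert_slack r hr s hs hs' hX i₀
  have hodd : Odd #Ω := by
    rw [card_eq_sum_card_image (fun p : Finset X × X => p.1.erase p.2)]
    have hmem : τ₀ ∈ Ω.image fun p => p.1.erase p.2 := by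
      obtain ⟨p, hp⟩ := card_pos.1 (hone ▸ Nat.one_pos)
      obtain ⟨hp, h⟩ := mem_filter.1 hp
      exact mem_image.2 ⟨p, hp, h⟩
    rw [← add_sum_erase _ _ hmem, hone]
    refine odd_one.add_even (even_sum _ fun τ hτ => ?_)
    obtain ⟨hne, hτ⟩ := mem_erase.1 hτ
    obtain ⟨p, hp, rfl⟩ := mem_image.1 hτ
    obtain ⟨-, hcard, hd, hxS, hpc⟩ := mem_filter.1 hp
    have hcard' : #(p.1.erase p.2) + 1 = Fintype.card ι := by
      rw [card_erase_of_mem hxS, hcard]; lia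
    rw [hfib _ hcard' hpc]
    obtain ⟨t, ht, hts⟩ : ∃ t ∈ p.1.erase p.2, t ∉ Set.range s := by
      by_contra! hcon
      refine hne (eq_of_subset_of_card_le (fun x hx => ?_) (by lia))
      obtain ⟨i, rfl⟩ := hcon x hx
      refine mem_image_of_mem _ ?_
      rw [← hpc, ← hc i]
      simpa only [hc] using mem_image_of_mem c hx
    exact even_card_filter_isDominating_insert r hr s _ hcard' t ht (hs' t hts)
  exact Nat.not_even_iff_odd.2 hodd heven

open Finset in
/-- A discrete fixed point lemma on the grid of integer points of a dilated simplex: for every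
colouring of the grid there are a grid point and points of each colour close to it, except that
a colour may be missing if the corresponding coordinate is small. -/
theorem exists_piAntidiag_forall_color_near {ι : Type*} [Fintype ι] [Nonempty ι] [DecidableEq ι]
    (N : ℕ) (c : (ι → ℕ) → ι) :
    ∃ a ∈ piAntidiag (univ : Finset ι) N, ∀ i, a i ≤ Fintype.card ι ∨
      ∃ b ∈ piAntidiag (univ : Finset ι) N, c b = i ∧
        ∀ l, a l ≤ b l + Fintype.card ι ∧ b l ≤ a l + Fintype.card ι := by
  let T := {a : ι → ℕ // a ∈ piAntidiag (univ : Finset ι) N}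
  have hT : ∀ a : T, ∑ i, a.1 i = N := fun a => (mem_piAntidiag.1 a.2).1
  let X := T ⊕ ι
  let v : ι → X → ℤ := fun i => Sum.elim (fun a => (a.1 i : ℤ)) fun j => if i = j then -1 else N + 1
  let e := Fintype.equivFin X
  let r : ι → X → ℤ ×ₗ Fin (Fintype.card X) := fun i x => toLex (v i x, e x)
  have hlt : ∀ i x y, v i x < v i y → r i x < r i y := fun i x y h =>
    Prod.Lex.toLex_lt_toLex.2 (Or.inl h)
  have hle : ∀ i x y, r i x ≤ r i y → v i x ≤ v i y := fun i x y h => by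
    rcases Prod.Lex.toLex_le_toLex.1 h with h | h
    exacts [h.le, h.1.le]
  have haN : ∀ (a : T) i, a.1 i ≤ N := fun a i =>
    (single_le_sum (fun _ _ => Nat.zero_le _) (mem_univ i)).trans_eq (hT a)
  have hpt : ∀ (b : ι → ℕ) (j : ι), ∑ i, b i ≤ N → ∃ a : T, ∀ i, b i ≤ a.1 i := by
    intro b j hb
    refine ⟨⟨b + Pi.single j (N - ∑ i, b i), ?_⟩, fun i => by simp⟩
    simp [mem_piAntidiag, sum_add_distrib, hb]
  obtain ⟨j₀⟩ := ‹Nonempty ι›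
  obtain ⟨t, -⟩ := hpt 0 j₀ (by simp)
  obtain ⟨S, hS, hSc⟩ := exists_isDominating_image_eq_univ r
    (fun i x y h => e.injective (congrArg Prod.snd (toLex.injective h))) (Sum.inr : ι → X)
    (fun i x hx => hlt i _ _ <| by
      rcases x with a | j
      · simp only [v, Sum.elim_inl, Sum.elim_inr, if_true]; lia
      · have : i ≠ j := fun h => hx (h ▸ rfl)
        simp only [v, Sum.elim_inr, if_true, if_neg this]; lia)
    (fun x hx i j hij => hlt i _ _ <| by
      rcases x with a | l
      · have := haN a i
        simp only [v, Sum.elim_inl, Sum.elim_inr, if_neg hij]; lia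
      · exact (hx ⟨l, rfl⟩).elim)
    ⟨Sum.inl t, by simp⟩ (Sum.elim (fun a => c a.1) id) (fun i => rfl)
  have hcol : ∀ i, Sum.inr i ∉ S → ∃ a : T, Sum.inl a ∈ S ∧ c a.1 = i := by
    intro i hi
    obtain ⟨x, hx, hxi⟩ := mem_image.1 (hSc ▸ mem_univ i)
    rcases x with a | j
    · exact ⟨a, hx, hxi⟩
    · exact (hi (hxi ▸ hx)).elim
  obtain ⟨j₁, hj₁⟩ : ∃ j, Sum.inr j ∉ S := by
    by_contra! h
    obtain ⟨i, hi⟩ := hS (Sum.inl t)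
    have := hle _ _ _ (hi _ (h i))
    simp only [v, Sum.elim_inl, Sum.elim_inr, if_true] at this
    lia
  obtain ⟨a₀, ha₀, -⟩ := hcol j₁ hj₁
  have hmin : ∀ i, ∃ a : T, Sum.inl a ∈ S ∧ ∀ b : T, Sum.inl b ∈ S → a.1 i ≤ b.1 i := by
    intro i
    obtain ⟨a, ha, hmin⟩ := exists_min_image {a : T | Sum.inl a ∈ S} (fun a => a.1 i)
      ⟨a₀, by simpa using ha₀⟩
    exact ⟨a, by simpa using ha, fun b hb => hmin b (by simpa using hb)⟩
  choose m hmS hm using hmin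
  let b : ι → ℕ := fun i => if Sum.inr i ∈ S then 0 else (m i).1 i + 1
  have hbN : N < ∑ i, b i := by
    by_contra! h
    obtain ⟨y, hy⟩ := hpt b j₁ h
    obtain ⟨i, hi⟩ := hS (Sum.inl y)
    by_cases hiS : Sum.inr i ∈ S
    · have := hle _ _ _ (hi _ hiS)
      simp only [v, Sum.elim_inl, Sum.elim_inr, if_true] at this
      lia
    · have h1 := hle _ _ _ (hi _ (hmS i))
      have h2 := hy i
      simp only [v, Sum.elim_inl, b, if_neg hiS] at h1 h2
      lia
  have hlow : ∀ a : T, Sum.inl a ∈ S → ∀ i, b i ≤ a.1 i + 1 := by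
    intro a ha i
    by_cases hiS : Sum.inr i ∈ S
    · simp [b, hiS]
    · simpa [b, hiS] using hm i a ha
  have hupp : ∀ a : T, Sum.inl a ∈ S → ∀ i, a.1 i + 1 ≤ b i + Fintype.card ι := by
    intro a ha i
    by_contra! hcon
    have h1 : ∑ l ∈ univ.erase i, b l ≤ ∑ l ∈ univ.erase i, (a.1 l + 1) :=
      sum_le_sum fun l _ => hlow a ha l
    rw [sum_add_distrib, sum_const, card_erase_of_mem (mem_univ _), card_univ, smul_eq_mul,
      mul_one] at h1
    have h2 := add_sum_erase univ b (mem_univ i)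
    have h3 := add_sum_erase univ a.1 (mem_univ i)
    have h4 := hT a
    have : 0 < Fintype.card ι := Fintype.card_pos_iff.2 ⟨i⟩
    lia
  refine ⟨a₀.1, a₀.2, fun i => ?_⟩
  by_cases hiS : Sum.inr i ∈ S
  · left
    have := hupp a₀ ha₀ i
    simp only [b, if_pos hiS] at this
    lia
  · right
    obtain ⟨a, ha, hai⟩ := hcol i hiS
    refine ⟨a.1, a.2, hai, fun l => ?_⟩
    have := hupp a₀ ha₀ l
    have := hupp a ha l
    have := hlow a₀ ha₀ l
    have := hlow a ha l
    lia

open Finset in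
/-- A form of the **Knaster–Kuratowski–Mazurkiewicz lemma**: if closed sets `C i` cover the standard
simplex and each `C i` contains the facet opposite to the vertex `i`, then they have a
common point in the simplex. -/
theorem exists_mem_stdSimplex_forall_mem_of_isClosed {ι : Type*} [Fintype ι] [Nonempty ι]
    (C : ι → Set (ι → ℝ)) (hC : ∀ i, IsClosed (C i))
    (hcov : ∀ w ∈ stdSimplex ℝ ι, ∃ i, w ∈ C i)
    (hfacet : ∀ w ∈ stdSimplex ℝ ι, ∀ i, w i = 0 → w ∈ C i) :
    ∃ w ∈ stdSimplex ℝ ι, ∀ i, w ∈ C i := by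
  classical
  by_contra! hno
  let U : ι → Set (ι → ℝ) := fun i => (C i)ᶜ ∩ {w | w i ≠ 0}
  obtain ⟨δ, hδ, hU⟩ := lebesgue_number_lemma_of_metric (isCompact_stdSimplex ℝ ι)
    (c := U) (fun i => (hC i).isOpen_compl.inter
      (isOpen_ne_fun (continuous_apply i) continuous_const))
    (fun w hw => by
      obtain ⟨i, hi⟩ := hno w hw
      exact Set.mem_iUnion.2 ⟨i, hi, fun h => hi (hfacet w hw i h)⟩)
  obtain ⟨N, hN⟩ := exists_nat_gt ((Fintype.card ι : ℝ) / δ)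
  have hN0 : (0 : ℝ) < N := lt_of_le_of_lt (by positivity) hN
  have hNδ : (Fintype.card ι : ℝ) / N < δ := by
    rw [div_lt_iff₀ hδ] at hN
    rw [div_lt_iff₀ hN0]
    linarith
  let w : (ι → ℕ) → ι → ℝ := fun a i => a i / N
  have hw : ∀ a ∈ piAntidiag (univ : Finset ι) N, w a ∈ stdSimplex ℝ ι := by
    intro a ha
    refine ⟨fun i => by positivity, ?_⟩
    simp only [w]
    rw [← sum_div, ← Nat.cast_sum, (mem_piAntidiag.1 ha).1, div_self hN0.ne']
  have hc : ∀ a : ι → ℕ, ∃ i, a ∈ piAntidiag (univ : Finset ι) N → w a ∈ C i := by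
    intro a
    by_cases ha : a ∈ piAntidiag (univ : Finset ι) N
    · exact (hcov _ (hw a ha)).imp fun i hi _ => hi
    · exact ⟨Classical.arbitrary ι, fun h => (ha h).elim⟩
  choose c hc using hc
  obtain ⟨a, ha, h⟩ := exists_piAntidiag_forall_color_near N c
  obtain ⟨i, hi⟩ := hU _ (hw a ha)
  rcases h i with h | ⟨b, hb, hbi, hab⟩
  · refine (hi (a := Function.update (w a) i 0) ?_).2 (by simp)
    rw [Metric.mem_ball, dist_pi_lt_iff hδ]
    intro l
    by_cases hl : l = i
    · subst hl
      have : (a l : ℝ) ≤ Fintype.card ι := by exact_mod_cast h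
      simp only [Function.update_self, w, Real.dist_eq, zero_sub, abs_neg]
      rw [abs_of_nonneg (by positivity)]
      exact lt_of_le_of_lt (by gcongr) hNδ
    · simpa [Function.update_of_ne hl] using hδ
  · refine (hi (a := w b) ?_).1 (hbi ▸ hc b hb)
    rw [Metric.mem_ball, dist_pi_lt_iff hδ]
    intro l
    have h1 : (a l : ℝ) ≤ b l + Fintype.card ι := by exact_mod_cast (hab l).1
    have h2 : (b l : ℝ) ≤ a l + Fintype.card ι := by exact_mod_cast (hab l).2
    simp only [w, Real.dist_eq]
    rw [← sub_div, abs_div, abs_of_pos hN0]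
    refine lt_of_le_of_lt ?_ hNδ
    gcongr
    rw [abs_le]
    constructor <;> linarith

/-- The **Hartman–Stampacchia** variational inequality on a polytope. -/
theorem exists_mem_convexHull_forall_dotProduct_sub_nonpos {κ : Type*} [Fintype κ]
    (V : Finset (κ → ℝ)) (hV : V.Nonempty) (q : (κ → ℝ) → κ → ℝ)
    (hq : ContinuousOn q (convexHull ℝ (V : Set (κ → ℝ)))) :
    ∃ x ∈ convexHull ℝ (V : Set (κ → ℝ)), ∀ z ∈ convexHull ℝ (V : Set (κ → ℝ)),
      q x ⬝ᵥ z ≤ q x ⬝ᵥ x := by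
  have : Nonempty V := hV.to_subtype
  let h : (V → ℝ) → κ → ℝ := fun w => ∑ v, w v • v.1
  have hmem : ∀ w ∈ stdSimplex ℝ V, h w ∈ convexHull ℝ (V : Set (κ → ℝ)) := fun w hw =>
    (convex_convexHull ℝ _).sum_mem (fun v _ => hw.1 v) hw.2
      fun v _ => subset_convexHull ℝ _ v.2
  have hh : Continuous h := by fun_prop
  have hqh : ContinuousOn (fun w => q (h w)) (stdSimplex ℝ V) := hq.comp hh.continuousOn hmem
  let g : V → (V → ℝ) → ℝ := fun v w => q (h w) ⬝ᵥ (v.1 - h w)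
  have hg : ∀ v, ContinuousOn (g v) (stdSimplex ℝ V) := by
    intro v
    simp only [g, dotProduct]
    refine continuousOn_finsetSum _ fun i _ => ?_
    refine ((continuousOn_pi.1 hqh i).mul ?_)
    fun_prop
  let s : (V → ℝ) → ℝ := fun w => ∑ v, max 0 (g v w)
  have hs : ContinuousOn s (stdSimplex ℝ V) :=
    continuousOn_finsetSum _ fun v _ => continuousOn_const.sup (hg v)
  obtain ⟨w, hw, hle⟩ := exists_mem_stdSimplex_forall_mem_of_isClosed
    (fun v => {w ∈ stdSimplex ℝ V | w v * s w ≤ max 0 (g v w)})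
    (fun v => (isClosed_stdSimplex ℝ V).isClosed_le
      ((continuous_apply v).continuousOn.mul hs) (continuousOn_const.sup (hg v)))
    (fun w hw => by
      by_contra! hcon
      have : ∑ v, max 0 (g v w) < ∑ v, w v * s w :=
        Finset.sum_lt_sum_of_nonempty Finset.univ_nonempty fun v _ =>
          not_le.1 fun h => hcon v ⟨hw, h⟩
      rw [← Finset.sum_mul, hw.2, one_mul] at this
      exact lt_irrefl _ this)
    (fun w hw v hv => ⟨hw, by simp [hv]⟩)
  have hsum : ∑ v, w v * g v w = 0 := by
    have h1 : ∑ v, w v * g v w = q (h w) ⬝ᵥ ∑ v, w v • (v.1 - h w) := by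
      simp only [g, dotProduct_sum, dotProduct_smul, smul_eq_mul]
    rw [h1]
    simp only [smul_sub, Finset.sum_sub_distrib, ← Finset.sum_smul, hw.2, one_smul]
    simp [h]
  have hsz : s w ≤ 0 := by
    by_contra! hpos
    have hgpos : ∀ v, 0 < w v → 0 < g v w := fun v hv => by
      have := (mul_pos hv hpos).trans_le (hle v).2
      simpa using this
    have hnn : ∀ v ∈ Finset.univ, 0 ≤ w v * g v w := fun v _ => by
      rcases (hw.1 v).eq_or_lt with h | h
      · simp [← h]
      · exact (mul_pos h (hgpos v h)).le
    have hz : ∀ v, w v = 0 := fun v => by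
      by_contra hv
      have hv := lt_of_le_of_ne (hw.1 v) (Ne.symm hv)
      exact (mul_pos hv (hgpos v hv)).ne' ((Finset.sum_eq_zero_iff_of_nonneg hnn).1 hsum v
        (Finset.mem_univ v))
    have := hw.2
    simp [hz] at this
  have hgle : ∀ v, g v w ≤ 0 := fun v =>
    (le_max_right 0 _).trans ((Finset.single_le_sum (f := fun v => max 0 (g v w))
      (fun v _ => le_max_left _ _) (Finset.mem_univ v)).trans hsz)
  refine ⟨h w, hmem w hw, fun z hz => ?_⟩
  refine convexHull_min (t := {z | q (h w) ⬝ᵥ z ≤ q (h w) ⬝ᵥ h w}) (fun v hv => ?_)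
    (convex_halfSpace_le ⟨dotProduct_add _, fun c z => dotProduct_smul c _ z⟩ _) hz
  have := hgle ⟨v, hv⟩
  simp only [g, dotProduct_sub] at this
  exact sub_nonpos.1 this

/-- A continuous self-map of a polytope that preserves every exposed face is surjective. -/
theorem exists_eq_of_forall_isExposed_mapsTo {κ : Type*} [Fintype κ] (V : Finset (κ → ℝ))
    (f : (κ → ℝ) → κ → ℝ) (hf : ContinuousOn f (convexHull ℝ (V : Set (κ → ℝ))))
    (hface : ∀ σ, IsExposed ℝ (convexHull ℝ (V : Set (κ → ℝ))) σ → Set.MapsTo f σ σ)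
    (p : κ → ℝ) (hp : p ∈ convexHull ℝ (V : Set (κ → ℝ))) :
    ∃ x ∈ convexHull ℝ (V : Set (κ → ℝ)), f x = p := by
  have hV : V.Nonempty := by
    simpa using convexHull_nonempty_iff.1 ⟨p, hp⟩
  obtain ⟨x, hx, hmax⟩ := exists_mem_convexHull_forall_dotProduct_sub_nonpos V hV
    (fun x => p - f x) (continuousOn_const.sub hf)
  let l : StrongDual ℝ (κ → ℝ) := LinearMap.toContinuousLinearMap
    { toFun := fun z => (p - f x) ⬝ᵥ z
      map_add' := dotProduct_add _
      map_smul' := fun c z => dotProduct_smul c _ z }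
  have hfx := hface _ (ContinuousLinearMap.toExposed.isExposed (l := l)) (x := x) ⟨hx, hmax⟩
  have h : (p - f x) ⬝ᵥ p ≤ (p - f x) ⬝ᵥ f x := hfx.2 p hp
  have h0 : (p - f x) ⬝ᵥ (p - f x) ≤ 0 := by
    rw [dotProduct_sub]
    exact sub_nonpos.2 h
  refine ⟨x, hx, (sub_eq_zero.1 (dotProduct_self_eq_zero.1 (le_antisymm h0 ?_))).symm⟩
  exact Finset.sum_nonneg fun i _ => mul_self_nonneg _

/-- A polytope has finitely many exposed faces. -/
theorem finite_setOf_isExposed_convexHull {E : Type*} [AddCommGroup E] [Module ℝ E]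
    [TopologicalSpace E] (V : Finset E) :
    {σ | IsExposed ℝ (convexHull ℝ (V : Set E)) σ}.Finite := by
  have key : ∀ σ, IsExposed ℝ (convexHull ℝ (V : Set E)) σ → convexHull ℝ (σ ∩ V) = σ := by
    intro σ hσ
    rcases σ.eq_empty_or_nonempty with rfl | hne
    · simp
    refine (convexHull_min Set.inter_subset_left (hσ.convex (convex_convexHull ℝ _))).antisymm ?_
    intro x hx
    obtain ⟨l, rfl⟩ := hσ hne
    obtain ⟨w, hw0, hw1, hwx⟩ := Finset.mem_convexHull'.1 hx.1
    have hVx : ∀ v ∈ V, l v ≤ l x := fun v hv => hx.2 v (subset_convexHull ℝ _ hv)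
    have hsum : ∑ v ∈ V, w v * (l x - l v) = 0 := by
      simp only [mul_sub, Finset.sum_sub_distrib, ← Finset.sum_mul, hw1]
      conv_lhs => rw [← hwx]
      simp [map_sum]
    have hz := (Finset.sum_eq_zero_iff_of_nonneg fun v hv =>
      mul_nonneg (hw0 v hv) (sub_nonneg.2 (hVx v hv))).1 hsum
    have hsupp : ∀ v ∈ V, w v ≠ 0 → v ∈ {x ∈ convexHull ℝ (V : Set E) |
        ∀ y ∈ convexHull ℝ (V : Set E), l y ≤ l x} ∩ V := by
      intro v hv hne
      have hlv : l x = l v := sub_eq_zero.1 ((mul_eq_zero.1 (hz v hv)).resolve_left hne)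
      exact ⟨⟨subset_convexHull ℝ _ hv, fun y hy => hlv ▸ hx.2 y hy⟩, hv⟩
    rw [← hwx, ← Finset.sum_filter_of_ne (p := fun v => w v ≠ 0)
      fun v _ h h' => h (by rw [h', zero_smul])]
    refine (convex_convexHull ℝ _).sum_mem (fun v hv => hw0 v (Finset.mem_filter.1 hv).1) ?_ ?_
    · rw [Finset.sum_filter_ne_zero, hw1]
    · intro v hv
      obtain ⟨hv, hne⟩ := Finset.mem_filter.1 hv
      exact subset_convexHull ℝ _ (hsupp v hv hne)
  refine Set.Finite.of_finite_image (f := fun σ => σ ∩ (V : Set E))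
    (V.finite_toSet.finite_subsets.subset ?_) ?_
  · rintro _ ⟨σ, -, rfl⟩
    exact Set.inter_subset_right
  · intro σ hσ τ hτ h
    rw [← key σ hσ, ← key τ hτ]
    exact congrArg _ h

/-- **Komiya's theorem, open-cover version.** Let `P ⊆ ℝ^k` be a polytope, and for every
nonempty (exposed) face `σ` of `P` (including `P` itself) choose a point `y σ ∈ σ` and a
set `A σ ⊆ P` that is open in the subspace topology of `P`. If
`σ ⊆ ⋃ {A τ : τ ⊆ σ a nonempty face}` for every nonempty face `σ`, then there are
nonempty faces `σ₁, …, σ_m` with `y P ∈ conv{y σ₁, …, y σ_m}` and `⋂ i, A (σ i) ≠ ∅`. -/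
theorem komiya_open (k : ℕ) (V : Finset (Fin k → ℝ)) (P : Set (Fin k → ℝ))
    (hP : P = convexHull ℝ (V : Set (Fin k → ℝ)))
    (hPne : P.Nonempty)
    (y : Set (Fin k → ℝ) → Fin k → ℝ)
    (A : Set (Fin k → ℝ) → Set (Fin k → ℝ))
    (hy : ∀ σ, IsExposed ℝ P σ → σ.Nonempty → y σ ∈ σ)
    (hAopen : ∀ σ, IsExposed ℝ P σ → σ.Nonempty →
      ∃ U : Set (Fin k → ℝ), IsOpen U ∧ A σ = U ∩ P)
    (hcover : ∀ σ, IsExposed ℝ P σ → σ.Nonempty →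
      σ ⊆ ⋃ τ ∈ {τ | IsExposed ℝ P τ ∧ τ.Nonempty ∧ τ ⊆ σ}, A τ) :
    ∃ (m : ℕ) (σs : Fin m → Set (Fin k → ℝ)),
      (∀ i, IsExposed ℝ P (σs i) ∧ (σs i).Nonempty) ∧
      y P ∈ convexHull ℝ (Set.range fun i => y (σs i)) ∧
      (⋂ i, A (σs i)).Nonempty := by
  classical
  have hfin : {σ | IsExposed ℝ P σ ∧ σ.Nonempty}.Finite := by
    refine Set.Finite.subset ?_ fun σ hσ => hσ.1
    rw [hP]
    exact finite_setOf_isExposed_convexHull V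
  have hPcomp : IsCompact P := hP ▸ V.finite_toSet.isCompact_convexHull ℝ
  let F := {σ : Set (Fin k → ℝ) // IsExposed ℝ P σ ∧ σ.Nonempty}
  have : Finite F := hfin
  have := Fintype.ofFinite F
  let B : F → Set P := fun σ => {x | x.1 ∈ A σ.1 ∧ ∀ ρ : F, x.1 ∈ ρ.1 → σ.1 ⊆ ρ.1}
  have hB : ∀ σ, IsOpen (B σ) := by
    intro σ
    obtain ⟨U, hU, hAU⟩ := hAopen σ.1 σ.2.1 σ.2.2
    have : B σ = Subtype.val ⁻¹' (U ∩ ⋂ ρ : {ρ : F // ¬ σ.1 ⊆ ρ.1}, ρ.1.1ᶜ) := by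
      ext x
      have hx : x.1 ∈ A σ.1 ↔ x.1 ∈ U := by simp [hAU]
      simp only [B, Set.mem_ofPred_eq, hx, Set.mem_preimage, Set.mem_inter_iff, Set.mem_iInter,
        Set.mem_compl_iff, Subtype.forall (p := fun ρ : F => ¬ σ.1 ⊆ ρ.1)]
      exact and_congr_right fun _ => forall_congr' fun ρ => by tauto
    rw [this]
    exact (hU.inter (isOpen_iInter_of_finite fun ρ =>
      (ρ.1.2.1.isClosed hPcomp.isClosed).isOpen_compl)).preimage continuous_subtype_val
  have hBcov : Set.univ ⊆ ⋃ σ, B σ := by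
    intro x _
    let G : Finset (Set (Fin k → ℝ)) := hfin.toFinset.filter fun ρ => x.1 ∈ ρ
    have hG : ∀ ρ, ρ ∈ G ↔ (IsExposed ℝ P ρ ∧ ρ.Nonempty) ∧ x.1 ∈ ρ := by simp [G]
    have hPG : P ∈ G := (hG P).2 ⟨⟨IsExposed.refl P, hPne⟩, x.2⟩
    have hxG : x.1 ∈ ⋂₀ (G : Set (Set (Fin k → ℝ))) := fun ρ hρ => ((hG ρ).1 hρ).2
    have hexp : IsExposed ℝ P (⋂₀ G) :=
      IsExposed.sInter ⟨P, hPG⟩ fun ρ hρ => ((hG ρ).1 hρ).1.1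
    obtain ⟨σ, ⟨h1, h2, h3⟩, hx⟩ := Set.mem_iUnion₂.1 (hcover _ hexp ⟨_, hxG⟩ hxG)
    refine Set.mem_iUnion.2 ⟨⟨σ, h1, h2⟩, hx, fun ρ hρ => h3.trans ?_⟩
    exact Set.sInter_subset_of_mem ((hG ρ.1).2 ⟨ρ.2, hρ⟩)
  have : CompactSpace P := isCompact_iff_compactSpace.1 hPcomp
  obtain ⟨φ, hφ⟩ := PartitionOfUnity.exists_isSubordinate isClosed_univ B hB hBcov
  have hφB : ∀ σ x, φ σ x ≠ 0 → x ∈ B σ := fun σ x h => hφ σ (subset_tsupport _ h)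
  have hφ1 : ∀ x, ∑ σ, φ σ x = 1 := fun x => by
    rw [← finsum_eq_sum_of_fintype]
    exact φ.sum_eq_one (Set.mem_univ x)
  let f : P → Fin k → ℝ := fun x => ∑ σ, φ σ x • y σ.1
  have hf : Continuous f := by fun_prop
  have hfmem : ∀ x (C : Set (Fin k → ℝ)), Convex ℝ C →
      (∀ σ, φ σ x ≠ 0 → y σ.1 ∈ C) → f x ∈ C := by
    intro x C hC h
    have : f x = ∑ σ with φ σ x ≠ 0, φ σ x • y σ.1 :=
      (Finset.sum_filter_of_ne (p := fun σ => φ σ x ≠ 0)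
        fun σ _ h h' => h (by rw [h', zero_smul])).symm
    rw [this]
    refine hC.sum_mem (fun σ _ => φ.nonneg σ x) ?_ fun σ hσ => h σ (Finset.mem_filter.1 hσ).2
    rw [Finset.sum_filter_ne_zero, hφ1]
  obtain ⟨x, hx, hfx⟩ := exists_eq_of_forall_isExposed_mapsTo V
    (fun x => if h : x ∈ P then f ⟨x, h⟩ else x)
    (by
      rw [← hP, continuousOn_iff_continuous_domRestrict]
      convert hf using 1
      ext x
      simp)
    (by
      rw [← hP]
      intro σ hσ x hx
      have hxP := hσ.subset hx
      simp only [dif_pos hxP]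
      refine hfmem _ _ (hσ.convex (hP ▸ convex_convexHull ℝ _)) fun ρ hρ => ?_
      exact (hφB ρ _ hρ).2 ⟨σ, hσ, x, hx⟩ hx (hy ρ.1 ρ.2.1 ρ.2.2))
    (y P) (hP ▸ hy P (IsExposed.refl P) hPne)
  rw [← hP] at hx
  simp only [dif_pos hx] at hfx
  let e := Fintype.equivFin {σ : F // φ σ ⟨x, hx⟩ ≠ 0}
  refine ⟨_, fun i => (e.symm i).1.1, fun i => (e.symm i).1.2, ?_, x, ?_⟩
  · rw [← hfx]
    refine hfmem _ _ (convex_convexHull ℝ _) fun σ hσ => subset_convexHull ℝ _ ⟨e ⟨σ, hσ⟩, ?_⟩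
    simp
  · exact Set.mem_iInter.2 fun i => (hφB _ _ (e.symm i).2).1
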